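/- arXiv:2604.00037 — 3 statements merged into one kernel-verified Lean document; each statement's English description precedes it below -/
import Mathlib

section
/- Let M be an m × n complex matrix of rank r, let I be a list of r row indices and J a list of r column indices such that the r × r submatrix M[I,J] (rows restricted to I, columns restricted to J) is invertible. Then the cross interpolation formula is exact: M = M[:,J] · (M[I,J])⁻¹ · M[I,:], where M[:,J] is the m × r matrix of the columns of M indexed by J and M[I,:] is the r × n matrix of the rows of M indexed by I. -/
namespace Matrix

/-- If some columns of `M` already have rank at least `M.rank`, then all columns of `M` are linear
combinations of them. -/
theorem exists_submatrix_mul_eq_of_rank_le {K m n l : Type*} [Field K] [Fintype n] [Fintype l]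
    (M : Matrix m n K) (J : l → n) (h : M.rank ≤ (M.submatrix id J).rank) :
    ∃ X : Matrix l n K, M.submatrix id J * X = M := by
  classical
  have hle : LinearMap.range (M.submatrix id J).mulVecLin ≤ LinearMap.range M.mulVecLin := by
    rw [range_mulVecLin, range_mulVecLin]
    apply Submodule.span_mono
    rintro _ ⟨j, rfl⟩
    exact ⟨J j, rfl⟩
  have heq := Submodule.eq_of_le_of_finrank_le hle h
  have hcol (j : n) : ∃ x : l → K, M.submatrix id J *ᵥ x = M.col j := by
    have hj : M.col j ∈ LinearMap.range M.mulVecLin :=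
      ⟨Pi.single j 1, by simp⟩
    rwa [← heq] at hj
  choose x hx using hcol
  exact ⟨of fun a j => x j a, by ext i j; exact congrFun (hx j) i⟩

end Matrix

/-- **Exactness of cross interpolation at full rank.**
If `M` is an `m × n` complex matrix of rank `r`, and `I`, `J` are lists of `r` row and
column indices such that the `r × r` pivot submatrix `M[I,J]` is invertible, then
`M = M[:,J] · (M[I,J])⁻¹ · M[I,:]`. -/
theorem cross_interpolation_exact (m n r : ℕ) (M : Matrix (Fin m) (Fin n) ℂ)
    (hrank : M.rank = r) (I : Fin r → Fin m) (J : Fin r → Fin n)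
    (hinv : IsUnit (M.submatrix I J)) :
    M = M.submatrix id J * (M.submatrix I J)⁻¹ * M.submatrix I id := by
  have hle : M.rank ≤ (M.submatrix id J).rank := by
    calc M.rank = (M.submatrix I J).rank := by
          rw [hrank, Matrix.rank_of_isUnit _ hinv, Fintype.card_fin]
      _ ≤ (M.submatrix id J).rank := (M.submatrix id J).rank_submatrix_le I id
  obtain ⟨X, hX⟩ := M.exists_submatrix_mul_eq_of_rank_le J hle
  have hrows : M.submatrix I id = M.submatrix I J * X := by
    ext a j
    exact (congrFun₂ hX (I a) j).symm
  rw [hrows, Matrix.mul_assoc, Matrix.nonsing_inv_mul_cancel_left _ _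
    ((Matrix.isUnit_iff_isUnit_det _).mp hinv), hX]
end

section
/- Let M be an m × n complex matrix, let I be a list of χ row indices and J a list of χ column indices such that the χ × χ submatrix M[I,J] is invertible, and set A := M[:,J] · (M[I,J])⁻¹ and B := M[I,:], so that AB is an m × n matrix. Then AB interpolates M exactly on the chosen crosses: (AB)[I,:] = M[I,:] and (AB)[:,J] = M[:,J], i.e., the cross interpolation AB agrees with M on every entry lying in a row indexed by I or in a column indexed by J, with no assumption on the rank of M. -/
/-- **Interpolation property of cross interpolation.**
For an `m × n` complex matrix `M` and lists `I`, `J` of `χ` row and column indices with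
`M[I,J]` invertible, the cross approximation `A·B` with `A = M[:,J] · (M[I,J])⁻¹` and
`B = M[I,:]` agrees with `M` on all rows indexed by `I` and all columns indexed by `J`:
`(AB)[I,:] = M[I,:]` and `(AB)[:,J] = M[:,J]`, without any assumption on the rank of `M`. -/
theorem cross_interpolation_interpolates (m n χ : ℕ) (M : Matrix (Fin m) (Fin n) ℂ)
    (I : Fin χ → Fin m) (J : Fin χ → Fin n)
    (hinv : IsUnit (M.submatrix I J)) :
    (M.submatrix id J * (M.submatrix I J)⁻¹ * M.submatrix I id).submatrix I id
        = M.submatrix I id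
    ∧ (M.submatrix id J * (M.submatrix I J)⁻¹ * M.submatrix I id).submatrix id J
        = M.submatrix id J := by
  have hdet : IsUnit (M.submatrix I J).det := (Matrix.isUnit_iff_isUnit_det _).mp hinv
  constructor
  · rw [Matrix.submatrix_mul _ _ I id id Function.bijective_id,
      Matrix.submatrix_mul _ _ I id id Function.bijective_id]
    simp only [Matrix.submatrix_submatrix, Matrix.submatrix_id_id, Function.id_comp,
      Function.comp_id]
    rw [Matrix.mul_nonsing_inv _ hdet, Matrix.one_mul]
  · rw [Matrix.submatrix_mul _ _ id id J Function.bijective_id]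
    simp only [Matrix.submatrix_submatrix, Matrix.submatrix_id_id, Function.id_comp,
      Function.comp_id]
    rw [Matrix.mul_assoc, Matrix.nonsing_inv_mul _ hdet, Matrix.mul_one]
end

section
/- Let M be an m × n complex matrix with rank(M) = r. Consider any sequence M = M_0, M_1, …, M_r where each M_{k+1} is obtained from M_k by one Gaussian elimination step with an arbitrary pivot (i_k, j_k) satisfying (M_k)_{i_k, j_k} ≠ 0, i.e., (M_{k+1})_{a,b} = (M_k)_{a,b} − (M_k)_{a,j_k} ((M_k)_{i_k,j_k})⁻¹ (M_k)_{i_k,b}. Then such pivots exist at every step k < r (each M_k with k < r is nonzero), and M_r = 0; equivalently, M is exactly the sum of the r rank-one cross terms eliminated along the way, M = Σ_{k=0}^{r−1} (column j_k of M_k)·((M_k)_{i_k,j_k})⁻¹·(row i_k of M_k), regardless of how the nonzero pivots are chosen. -/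
/-- The Schur complement of a matrix with respect to a nonzero pivot has strictly smaller rank. -/
theorem Matrix.rank_schurComplement_pivot_lt {K ι κ : Type*} [Field K] [Finite ι] [Fintype κ]
    (A : Matrix ι κ K) (i : ι) (j : κ) (hij : A i j ≠ 0) :
    (Matrix.of fun a b => A a b - A a j * (A i j)⁻¹ * A i b).rank < A.rank := by
  rw [Matrix.rank_eq_finrank_span_cols, Matrix.rank_eq_finrank_span_cols]
  have hcol : ∀ b, A.col b ∈ Submodule.span K (Set.range A.col) := fun b =>
    Submodule.subset_span ⟨b, rfl⟩
  refine Submodule.finrank_lt_finrank_of_lt (SetLike.lt_iff_le_and_exists.mpr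
    ⟨Submodule.span_le.mpr ?_, A.col j, hcol j, fun hj => hij ?_⟩)
  · rintro _ ⟨b, rfl⟩
    rw [SetLike.mem_coe]
    convert Submodule.sub_mem _ (hcol b) (Submodule.smul_mem _ ((A i j)⁻¹ * A i b) (hcol j)) using 1
    ext a
    simp only [Matrix.col_apply, Matrix.of_apply, Pi.sub_apply, Pi.smul_apply, smul_eq_mul]
    ring
  · have hle : Submodule.span K
        (Set.range (Matrix.of fun a b => A a b - A a j * (A i j)⁻¹ * A i b).col) ≤
        LinearMap.ker (LinearMap.proj i : (ι → K) →ₗ[K] K) := by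
      refine Submodule.span_le.mpr ?_
      rintro _ ⟨b, rfl⟩
      simp [hij]
    simpa using hle hj

/-- **Full rank-revealing elimination (prrLU elimination loop).**
Let `M` have rank `r` and let `M = M_0, M_1, …, M_r` be any sequence where `M_{k+1}` is the
Schur complement of `M_k` with respect to an arbitrary nonzero pivot `(i_k, j_k)`. Then a
nonzero pivot exists at every step `k < r` (each `M_k` with `k < r` is nonzero), the process
terminates with `M_r = 0`, and `M` equals the sum of the `r` eliminated rank-one cross
terms, regardless of how the nonzero pivots were chosen. -/
theorem prrLU_elimination (m n r : ℕ) (M : Matrix (Fin m) (Fin n) ℂ)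
    (hrank : M.rank = r)
    (Ms : ℕ → Matrix (Fin m) (Fin n) ℂ) (hM0 : Ms 0 = M)
    (pI : (k : ℕ) → k < r → Fin m) (pJ : (k : ℕ) → k < r → Fin n)
    (hpiv : ∀ (k : ℕ) (h : k < r), Ms k (pI k h) (pJ k h) ≠ 0)
    (hstep : ∀ (k : ℕ) (h : k < r), Ms (k + 1) = Matrix.of fun a b =>
        Ms k a b - Ms k a (pJ k h) * (Ms k (pI k h) (pJ k h))⁻¹ * Ms k (pI k h) b) :
    (∀ k < r, Ms k ≠ 0) ∧ Ms r = 0 ∧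
      M = ∑ k ∈ (Finset.range r).attach,
        Matrix.of fun a b =>
          Ms k a (pJ k (Finset.mem_range.mp k.2)) *
            (Ms k (pI k (Finset.mem_range.mp k.2)) (pJ k (Finset.mem_range.mp k.2)))⁻¹ *
            Ms k (pI k (Finset.mem_range.mp k.2)) b := by
  have hle : ∀ k ≤ r, (Ms k).rank + k ≤ r := by
    intro k
    induction k with
    | zero => simp [hM0, hrank]
    | succ k ih =>
      intro hk
      have hlt := Matrix.rank_schurComplement_pivot_lt (Ms k) _ _ (hpiv k hk)
      rw [← hstep k hk] at hlt
      have := ih (Nat.le_of_succ_le hk)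
      omega
  have hr : Ms r = 0 := by
    have h0 : (Ms r).rank = 0 := by
      have := hle r le_rfl
      omega
    rw [Matrix.rank, Submodule.finrank_eq_zero, LinearMap.range_eq_bot] at h0
    exact Matrix.ext_of_mulVec_single fun j => by
      ext i
      simpa using congrFun (LinearMap.congr_fun h0 (Pi.single j 1)) i
  refine ⟨fun k hk h0 => hpiv k hk (by simp [h0]), hr, ?_⟩
  calc M = ∑ k ∈ Finset.range r, (Ms k - Ms (k + 1)) := by
        rw [Finset.sum_range_sub', hr, hM0, sub_zero]
    _ = ∑ k ∈ (Finset.range r).attach, (Ms k - Ms (k + 1)) :=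
        (Finset.sum_attach (Finset.range r) fun k => Ms k - Ms (k + 1)).symm
    _ = _ := by
        refine Finset.sum_congr rfl fun k _ => ?_
        rw [hstep k (Finset.mem_range.mp k.2)]
        ext a b
        simp
end
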